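/- Let d ≥ 1 and let λ, μ be partitions of n ≥ 1. Then χ^{⊞^d(λ)}_{⊞^d(μ)} = Σ (∏_{i≥1} m_i(μ^{⊎d})! / (m_i(τ_1)! ⋯ m_i(τ_d)!)) · χ^λ_{τ_1} ⋯ χ^λ_{τ_d}, where the sum ranges over all d-tuples (τ_1, …, τ_d) of partitions of n whose multiset union τ_1 ⊎ ⋯ ⊎ τ_d equals μ^{⊎d}, the multiset union of d copies of μ, and where each factor ∏_{i≥1} m_i(μ^{⊎d})!/(m_i(τ_1)!⋯m_i(τ_d)!) is a product of multinomial coefficients (in particular a positive integer). (This sum is the character value, at a permutation of cycle type μ embedded diagonally in S_n^d ⊆ S_{dn}, of the d-fold induction product Ind_{S_n^d}^{S_{dn}}(V^λ ⊗ ⋯ ⊗ V^λ).) -/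

import Mathlib

open MvPolynomial Finset

/-- The `r`-th power sum polynomial `p_r = x_1^r + ⋯ + x_N^r`. -/
noncomputable def psum (N r : ℕ) : MvPolynomial (Fin N) ℤ := ∑ i, X i ^ r

/-- The power sum product `p_μ = p_{μ_1} ⋯ p_{μ_k}` for a partition `μ`. -/
noncomputable def pprod (N : ℕ) {n : ℕ} (mu : Nat.Partition n) : MvPolynomial (Fin N) ℤ :=
  (mu.parts.map (psum N)).prod

/-- The Vandermonde product `∏_{i<j} (x_i - x_j)`. -/
noncomputable def vandermonde (N : ℕ) : MvPolynomial (Fin N) ℤ :=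
  ∏ p ∈ univ.filter (fun p : Fin N × Fin N => p.1 < p.2), (X p.1 - X p.2)

/-- The irreducible character value `χ^λ_μ` of `S_N`, via the Frobenius character formula:
the coefficient of `x_1^{λ_1 + N - 1} x_2^{λ_2 + N - 2} ⋯ x_N^{λ_N}` in `∏_{i<j}(x_i - x_j) ⋅ p_μ`,
where `λ` is padded with trailing zeros to length `N`. -/
noncomputable def chi {N : ℕ} (l m : Nat.Partition N) : ℤ :=
  coeff (Finsupp.equivFunOnFinite.symm fun i : Fin N =>
    (l.parts.sort (· ≥ ·)).getD i 0 + (N - 1 - (i : ℕ))) (vandermonde N * pprod N m)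

/-- `⊞^d(λ)`: replace each part `p` of `λ` by `d` copies of `d⋅p`; a partition of `d²n`. -/
def boxplus (d : ℕ) {n : ℕ} (P : Nat.Partition n) : Nat.Partition (d * (d * n)) where
  parts := P.parts.bind fun p => Multiset.replicate d (d * p)
  parts_pos := by
    intro i hi
    simp only [Multiset.mem_bind, Multiset.mem_replicate] at hi
    obtain ⟨p, hp, hd, rfl⟩ := hi
    exact Nat.mul_pos (Nat.pos_of_ne_zero hd) (P.parts_pos hp)
  parts_sum := by
    rw [Multiset.sum_bind]
    simp only [Multiset.sum_replicate, smul_eq_mul]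
    rw [Multiset.sum_map_mul_left, Multiset.sum_map_mul_left, Multiset.map_id', P.parts_sum]

/-- The coefficient defining `chi`, for an arbitrary number `K` of variables. -/
noncomputable def alternantCoeff (K : ℕ) (l : ℕ → ℕ) (s : Multiset ℕ) : ℤ :=
  coeff (Finsupp.equivFunOnFinite.symm fun i : Fin K => l i + (K - 1 - (i : ℕ)))
    (vandermonde K * (s.map (_root_.psum K)).prod)

theorem chi_eq_alternantCoeff {N : ℕ} (l m : Nat.Partition N) :
    chi l m = alternantCoeff N (fun i => (l.parts.sort (· ≥ ·)).getD i 0) m.parts := rfl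

theorem vandermonde_eq_prod (K : ℕ) :
    vandermonde K = ∏ i : Fin K, ∏ j ∈ Ioi i, (X i - X j) := by
  rw [vandermonde, Finset.prod_sigma']
  refine Finset.prod_bij' (fun p _ => ⟨p.1, p.2⟩) (fun p _ => (p.1, p.2)) ?_ ?_ ?_ ?_ ?_ <;> simp

theorem vandermonde_eq_det (K : ℕ) :
    vandermonde K = (Matrix.of fun i j : Fin K =>
      (X i : MvPolynomial (Fin K) ℤ) ^ (K - 1 - (j : ℕ))).det := by
  have h := Matrix.det_projVandermonde (fun _ => 1) (X : Fin K → MvPolynomial (Fin K) ℤ)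
  simp only [one_mul] at h
  rw [vandermonde_eq_prod, ← h]
  congr 1
  ext1 i j
  rw [Matrix.projVandermonde_apply, one_pow, one_mul, Matrix.of_apply, Fin.val_rev]
  congr 1
  omega

theorem isHomogeneous_vandermonde (K : ℕ) :
    (vandermonde K).IsHomogeneous (∑ i : Fin K, (K - 1 - (i : ℕ))) := by
  rw [vandermonde_eq_det, Matrix.det_apply]
  refine IsHomogeneous.sum _ _ _ fun w _ => ?_
  have h : (∏ i, (X (w i) : MvPolynomial (Fin K) ℤ) ^ (K - 1 - (i : ℕ))).IsHomogeneous
      (∑ i : Fin K, (K - 1 - (i : ℕ))) :=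
    IsHomogeneous.prod _ _ _ fun i _ => isHomogeneous_X_pow _ _
  rcases Int.units_eq_one_or (Equiv.Perm.sign w) with hw | hw
  · simpa [hw] using h
  · simpa [hw] using h.neg

theorem isHomogeneous_prod_psum (K : ℕ) (s : Multiset ℕ) :
    (s.map (_root_.psum K)).prod.IsHomogeneous s.sum := by
  induction s using Multiset.induction with
  | empty => simpa using isHomogeneous_one _ _
  | cons a s ih =>
    rw [Multiset.map_cons, Multiset.prod_cons, Multiset.sum_cons]
    exact (IsHomogeneous.sum _ _ _ fun i _ => isHomogeneous_X_pow i a).mul ih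

theorem alternantCoeff_eq_zero {K : ℕ} {l : ℕ → ℕ} {s : Multiset ℕ}
    (h : ∑ i : Fin K, l i ≠ s.sum) : alternantCoeff K l s = 0 := by
  refine ((isHomogeneous_vandermonde K).mul (isHomogeneous_prod_psum K s)).coeff_eq_zero ?_
  rw [Finsupp.degree_eq_sum]
  simp only [Finsupp.equivFunOnFinite_symm_apply_apply, Finset.sum_add_distrib]
  omega

theorem killCompl_X_castSucc {K : ℕ} (i : Fin K) :
    killCompl (R := ℤ) (Fin.castSucc_injective K) (X i.castSucc) = X i := by
  rw [← rename_X, killCompl_rename_app]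

theorem killCompl_X_last (K : ℕ) :
    killCompl (R := ℤ) (Fin.castSucc_injective K) (X (Fin.last K)) = 0 := by
  rw [killCompl, aeval_X, dif_neg]
  rintro ⟨i, hi⟩
  exact (Fin.castSucc_lt_last i).ne hi

theorem killCompl_vandermonde (K : ℕ) :
    killCompl (Fin.castSucc_injective K) (vandermonde (K + 1)) =
      vandermonde K * ∏ i, X i := by
  have hI : Ioi (Fin.last K) = ∅ := by ext x; simp [Fin.le_last]
  rw [vandermonde_eq_prod, vandermonde_eq_prod, map_prod, Fin.prod_univ_castSucc, hI,
    Finset.prod_empty, map_one, mul_one, ← Finset.prod_mul_distrib]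
  refine Finset.prod_congr rfl fun i _ => ?_
  have hs : Ioi i.castSucc = insert (Fin.last K) ((Ioi i).map Fin.castSuccEmb) := by
    ext x
    refine Fin.lastCases ?_ (fun y => ?_) x
    · simp [Fin.castSucc_lt_last]
    · simp [Fin.le_last]
  rw [hs, Finset.prod_insert (by simp), map_mul, map_sub,
    killCompl_X_last, killCompl_X_castSucc, sub_zero, mul_comm, Finset.prod_map, map_prod]
  simp [killCompl_X_castSucc]

theorem killCompl_psum {K r : ℕ} (hr : r ≠ 0) :
    killCompl (Fin.castSucc_injective K) (_root_.psum (K + 1) r) = _root_.psum K r := by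
  simp [_root_.psum, Fin.sum_univ_castSucc, killCompl_X_castSucc, killCompl_X_last, hr]

theorem alternantCoeff_succ {K : ℕ} {l : ℕ → ℕ} {s : Multiset ℕ} (hl : l K = 0) (hs : 0 ∉ s) :
    alternantCoeff (K + 1) l s = alternantCoeff K l s := by
  have hexp : (Finsupp.equivFunOnFinite.symm fun i : Fin (K + 1) => l i + (K + 1 - 1 - (i : ℕ))) =
      (Finsupp.equivFunOnFinite.symm fun i : Fin K =>
        l i + (K - 1 - (i : ℕ)) + 1).mapDomain Fin.castSucc := by
    ext i
    refine Fin.lastCases ?_ (fun i => ?_) i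
    · rw [Finsupp.mapDomain_of_notMem_range _ _ (by simp)]
      simp [hl]
    · rw [Finsupp.mapDomain_apply (Fin.castSucc_injective K)]
      simp
      omega
  have hone : (∏ i : Fin K, X i : MvPolynomial (Fin K) ℤ) =
      monomial (Finsupp.equivFunOnFinite.symm fun _ => 1) 1 := by
    rw [monomial_eq, Finsupp.prod_fintype _ _ (by simp)]
    simp
  have hp : killCompl (Fin.castSucc_injective K) (s.map (_root_.psum (K + 1))).prod =
      (s.map (_root_.psum K)).prod := by
    rw [map_multiset_prod, Multiset.map_map]
    refine congrArg _ (Multiset.map_congr rfl fun r hr => killCompl_psum ?_)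
    rintro rfl
    exact hs hr
  rw [alternantCoeff, hexp, ← coeff_killCompl (Fin.castSucc_injective K), map_mul, hp,
    killCompl_vandermonde, hone, mul_right_comm, coeff_mul_monomial', if_pos, mul_one,
    alternantCoeff]
  · congr 1
    ext i
    simp
  · intro i
    simp

theorem alternantCoeff_stable {n K : ℕ} (h : n ≤ K) {l : ℕ → ℕ} {s : Multiset ℕ}
    (hl : ∀ i, n ≤ i → l i = 0) (hs : 0 ∉ s) :
    alternantCoeff K l s = alternantCoeff n l s := by
  induction K, h using Nat.le_induction with
  | base => rfl
  | succ K hK ih => rw [alternantCoeff_succ (hl K hK) hs, ih]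

theorem coeff_prod_X_pow_mul_expand {ι : Type*} [Fintype ι] {d : ℕ} (β ρ γ : ι → ℕ)
    (hρ : ∀ i, ρ i < d) (P : MvPolynomial ι ℤ) :
    coeff (Finsupp.equivFunOnFinite.symm fun i => d * β i + ρ i)
        ((∏ i, X i ^ γ i) * expand d P) =
      coeff (Finsupp.equivFunOnFinite.symm β)
        ((∏ i, if γ i % d = ρ i then X i ^ (γ i / d) else 0) * P) := by
  have hmon (γ : ι → ℕ) : (∏ i, X i ^ γ i : MvPolynomial ι ℤ) =
      monomial (Finsupp.equivFunOnFinite.symm γ) 1 := by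
    rw [monomial_eq, Finsupp.prod_fintype _ _ (by simp)]
    simp
  by_cases h : ∀ i, γ i % d = ρ i
  · have hγ (i) : γ i = d * (γ i / d) + ρ i := by rw [← h i, Nat.div_add_mod]
    rw [Finset.prod_congr rfl fun i _ => if_pos (h i), hmon, hmon, coeff_monomial_mul',
      coeff_monomial_mul']
    have hiff : (Finsupp.equivFunOnFinite.symm γ ≤
          Finsupp.equivFunOnFinite.symm fun i => d * β i + ρ i) ↔
        Finsupp.equivFunOnFinite.symm (fun i => γ i / d) ≤ Finsupp.equivFunOnFinite.symm β := by
      refine forall_congr' fun i => ?_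
      have hd : 0 < d := (Nat.zero_le _).trans_lt (hρ i)
      simp only [Finsupp.equivFunOnFinite_symm_apply_apply]
      conv_lhs => rw [hγ i]
      rw [Nat.add_le_add_iff_right, Nat.mul_le_mul_left_iff hd]
    by_cases hle : Finsupp.equivFunOnFinite.symm (fun i => γ i / d) ≤
        Finsupp.equivFunOnFinite.symm β
    · rw [if_pos hle, if_pos (hiff.2 hle), one_mul, one_mul]
      rcases eq_or_ne d 0 with rfl | hd
      · have : IsEmpty ι := ⟨fun i => absurd (hρ i) (Nat.not_lt_zero _)⟩
        rw [eq_C_of_isEmpty P]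
        simp only [Subsingleton.elim _ (0 : ι →₀ ℕ), expand_C]
      · rw [← coeff_expand_smul d hd P]
        congr 1
        ext i
        simp only [Finsupp.tsub_apply, Finsupp.smul_apply, smul_eq_mul,
          Finsupp.equivFunOnFinite_symm_apply_apply]
        conv_lhs => rw [hγ i]
        rw [Nat.add_sub_add_right, Nat.mul_sub]
    · rw [if_neg hle, if_neg (mt hiff.1 hle)]
  · push Not at h
    obtain ⟨i, hi⟩ := h
    rw [Finset.prod_eq_zero (f := fun i => if γ i % d = ρ i then _ else _) (mem_univ i)
      (if_neg hi), zero_mul,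
      coeff_zero, hmon, coeff_monomial_mul']
    split_ifs with hle
    · rw [one_mul]
      refine coeff_expand_of_not_dvd P (i := i) fun hdvd => hi ?_
      have hle := hle i
      simp only [Finsupp.tsub_apply, Finsupp.equivFunOnFinite_symm_apply_apply] at hdvd hle
      obtain ⟨c, hc⟩ := hdvd
      have hmod : (γ i + d * c) % d = (d * β i + ρ i) % d := by congr 1; omega
      rwa [Nat.add_mul_mod_self_left, Nat.mul_add_mod, Nat.mod_eq_of_lt (hρ i)] at hmod
    · rfl

theorem coeff_det_X_pow_mul_expand {ι : Type*} [Fintype ι] [DecidableEq ι] {d : ℕ}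
    (β ρ δ : ι → ℕ) (hρ : ∀ i, ρ i < d) (P : MvPolynomial ι ℤ) :
    coeff (Finsupp.equivFunOnFinite.symm fun i => d * β i + ρ i)
        ((Matrix.of fun i j => (X i : MvPolynomial ι ℤ) ^ δ j).det * expand d P) =
      coeff (Finsupp.equivFunOnFinite.symm β)
        ((Matrix.of fun i j =>
          if δ j % d = ρ i then (X i : MvPolynomial ι ℤ) ^ (δ j / d) else 0).det * P) := by
  rw [← Matrix.det_transpose, ← Matrix.det_transpose (Matrix.of _)]
  simp only [Matrix.det_apply, Finset.sum_mul, coeff_sum, smul_mul_assoc, coeff_smul,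
    Matrix.transpose_apply, Matrix.of_apply]
  refine Finset.sum_congr rfl fun w _ => ?_
  rw [coeff_prod_X_pow_mul_expand β ρ (fun i => δ (w i)) hρ P]

theorem coeff_prod_rename {ι κ : Type*} [Fintype ι] [Fintype κ] [DecidableEq κ]
    (f : κ → MvPolynomial ι ℤ) (β : ι × κ → ℕ) :
    coeff (Finsupp.equivFunOnFinite.symm β) (∏ r, rename (fun i => (i, r)) (f r)) =
      ∏ r, coeff (Finsupp.equivFunOnFinite.symm fun i => β (i, r)) (f r) := by
  classical
  have hinj (r : κ) : Function.Injective fun i : ι => (i, r) := fun i j h => congrArg Prod.fst h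
  have hsum (g : κ → ι →₀ ℕ) (i : ι) (r : κ) :
      (∑ r, (g r).mapDomain (fun i => (i, r))) (i, r) = g r i := by
    rw [Finsupp.finsetSum_apply, Finset.sum_eq_single r, Finsupp.mapDomain_apply (hinj r)]
    · intro r' _ hr
      exact Finsupp.mapDomain_of_notMem_range _ _ (by simpa using hr)
    · simp
  have hexpand (r : κ) : rename (fun i => (i, r)) (f r) =
      ∑ m ∈ (f r).support, monomial (m.mapDomain fun i => (i, r)) (coeff m (f r)) := by
    conv_lhs => rw [(f r).as_sum, map_sum]
    simp only [rename_monomial]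
  have hprod (g : κ → ι →₀ ℕ) :
      (∏ r, monomial ((g r).mapDomain fun i => (i, r)) (coeff (g r) (f r)) :
        MvPolynomial (ι × κ) ℤ) =
      monomial (∑ r, (g r).mapDomain fun i => (i, r)) (∏ r, coeff (g r) (f r)) := by
    rw [monomial_sum_index, map_prod, ← Finset.prod_mul_distrib]
    simp only [C_mul_monomial, mul_one]
  simp only [hexpand, Finset.prod_univ_sum, hprod, coeff_sum, coeff_monomial]
  rw [Finset.sum_eq_single fun r => Finsupp.equivFunOnFinite.symm fun i => β (i, r)]
  · rw [if_pos]
    ext ⟨i, r⟩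
    rw [hsum]
    rfl
  · intro g _ hg
    rw [if_neg]
    intro h
    refine hg (funext fun r => Finsupp.ext fun i => ?_)
    rw [← hsum g, h]
    rfl
  · intro h
    simp only [Fintype.mem_piFinset, mem_support_iff, not_forall, not_not] at h
    obtain ⟨r, hr⟩ := h
    rw [Finset.prod_eq_zero (mem_univ r) hr, ite_self]

theorem rev_mul_add {K d k r : ℕ} (hk : k < K) (hr : r < d) :
    K * d - 1 - (r + d * k) = d * (K - 1 - k) + (d - 1 - r) := by
  obtain ⟨t, rfl⟩ := Nat.exists_eq_add_of_lt hk
  have h1 : (k + t + 1) * d = d * k + d * t + d := by ring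
  have h2 : k + t + 1 - 1 - k = t := by omega
  rw [h1, h2]
  omega

theorem vandermonde_blocks (K d : ℕ) :
    (Matrix.of fun i j : Fin K × Fin d =>
      if (K * d - 1 - (finProdFinEquiv j : ℕ)) % d = d - 1 - (i.2 : ℕ) then
        (X i : MvPolynomial (Fin K × Fin d) ℤ) ^ ((K * d - 1 - (finProdFinEquiv j : ℕ)) / d)
      else 0).det = ∏ r : Fin d, rename (fun k => (k, r)) (vandermonde K) := by
  simp only [vandermonde_eq_det, AlgHom.map_det]
  rw [← Matrix.det_blockDiagonal]
  congr 1
  ext1 ⟨k, r⟩ ⟨l, s⟩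
  have hs : d - 1 - (s : ℕ) < d := by have := s.2; omega
  rw [Matrix.of_apply, finProdFinEquiv_apply_val, rev_mul_add l.2 s.2, Nat.mul_add_mod,
    Nat.mod_eq_of_lt hs, Nat.mul_add_div (Nat.zero_lt_of_lt hs), Nat.div_eq_of_lt hs, add_zero,
    Matrix.blockDiagonal_apply]
  have hiff : d - 1 - (s : ℕ) = d - 1 - (r : ℕ) ↔ r = s := by
    rw [Fin.ext_iff]
    have := r.2
    have := s.2
    omega
  simp only [hiff]
  congr 1
  simp

theorem alternantCoeff_mul {K d : ℕ} {l l' : ℕ → ℕ}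
    (hl : ∀ k, ∀ r < d, l' (d * k + r) = d * l k) (s : Multiset ℕ) :
    alternantCoeff (K * d) l' (s.map (d * ·)) =
      coeff (Finsupp.equivFunOnFinite.symm fun i : Fin K × Fin d => l i.1 + (K - 1 - (i.1 : ℕ)))
        ((∏ r : Fin d, rename (fun k => (k, r)) (vandermonde K)) *
          (s.map fun p => ∑ r : Fin d, rename (fun k => (k, r)) (_root_.psum K p)).prod) := by
  let e : Fin K × Fin d ≃ Fin (K * d) := finProdFinEquiv
  have hexp : (Finsupp.equivFunOnFinite.symm fun i : Fin (K * d) =>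
      l' i + (K * d - 1 - (i : ℕ))) =
      (Finsupp.equivFunOnFinite.symm fun i : Fin K × Fin d =>
        d * (l i.1 + (K - 1 - (i.1 : ℕ))) + (d - 1 - (i.2 : ℕ))).mapDomain e := by
    ext i
    obtain ⟨i, rfl⟩ := e.surjective i
    rw [Finsupp.mapDomain_apply e.injective]
    simp only [Finsupp.equivFunOnFinite_symm_apply_apply, e, finProdFinEquiv_apply_val]
    rw [rev_mul_add i.1.2 i.2.2, add_comm (i.2 : ℕ), hl _ _ i.2.2]
    ring
  have hvand : vandermonde (K * d) = rename e (Matrix.of fun i j : Fin K × Fin d =>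
      (X i : MvPolynomial (Fin K × Fin d) ℤ) ^ (K * d - 1 - (finProdFinEquiv j : ℕ))).det := by
    rw [AlgHom.map_det, vandermonde_eq_det, ← Matrix.det_submatrix_equiv_self e]
    congr 1
    ext1 i j
    simp [e]
  have hpsum : ((s.map (d * ·)).map (_root_.psum (K * d))).prod =
      rename e (expand d
        (s.map fun p => ∑ r : Fin d, rename (fun k => (k, r)) (_root_.psum K p)).prod) := by
    simp only [map_multiset_prod, Multiset.map_map]
    refine congrArg _ (Multiset.map_congr rfl fun p _ => ?_)
    simp only [Function.comp_apply, _root_.psum, map_sum, map_pow, rename_X, expand_X]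
    rw [← e.sum_comp, Fintype.sum_prod_type_right]
    simp [pow_mul]
  rw [alternantCoeff, hexp, hvand, hpsum, ← map_mul, coeff_rename_mapDomain _ e.injective,
    coeff_det_X_pow_mul_expand (fun i : Fin K × Fin d => l i.1 + (K - 1 - (i.1 : ℕ)))
      (fun i => d - 1 - (i.2 : ℕ)) _ (fun i => by have := i.2.2; omega),
    vandermonde_blocks]

theorem prod_map_sum_eq {A κ : Type*} [CommRing A] [Fintype κ] [DecidableEq κ] (F : κ → ℕ → A)
    {n : ℕ} {s : Multiset ℕ} (hs : ∀ p ∈ s, p ≤ n) :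
    (s.map fun p => ∑ r, F r p).prod =
      ∑ k ∈ Fintype.piFinset fun i : Fin (n + 1) => piAntidiag univ (s.count (i : ℕ)),
        ((∏ i, Nat.multinomial univ (k i) : ℕ) : A) *
          ∏ r, ((∑ i, Multiset.replicate (k i r) (i : ℕ)).map (F r)).prod := by
  have h : (s.map fun p => ∑ r, F r p).prod =
      ∏ i : Fin (n + 1), (∑ r, F r i) ^ s.count (i : ℕ) := by
    rw [Finset.prod_multiset_map_count,
      ← Finset.prod_range fun i => (∑ r, F r i) ^ s.count i]
    refine Finset.prod_subset (fun p hp => ?_) fun p _ hp => ?_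
    · simpa [Nat.lt_succ_iff] using hs p (by simpa using hp)
    · rw [Multiset.count_eq_zero_of_notMem (by simpa using hp), pow_zero]
  simp only [h, Finset.sum_pow_eq_sum_piAntidiag, Finset.prod_univ_sum]
  refine Finset.sum_congr rfl fun k _ => ?_
  rw [Finset.prod_mul_distrib, Nat.cast_prod, Finset.prod_comm]
  congr 1
  refine Finset.prod_congr rfl fun r _ => ?_
  rw [← Multiset.coe_mapAddMonoidHom, map_sum, Multiset.prod_sum]
  simp

theorem sum_replicate_count {n : ℕ} {s : Multiset ℕ} (hs : ∀ p ∈ s, p ≤ n) :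
    ∑ i : Fin (n + 1), Multiset.replicate (s.count (i : ℕ)) (i : ℕ) = s := by
  ext a
  rw [← Finset.sum_range fun i => Multiset.replicate (s.count i) i, Multiset.count_sum']
  simp only [Multiset.count_replicate]
  rw [Finset.sum_ite_eq', ite_eq_left_iff]
  intro ha
  rw [Multiset.count_eq_zero_of_notMem fun h => ha (by simpa [Nat.lt_succ_iff] using hs a h)]

theorem boxplus_parts (d : ℕ) {n : ℕ} (P : Nat.Partition n) :
    (boxplus d P).parts = (d • P.parts).map (d * ·) := by
  have (s : Multiset ℕ) : (s.bind fun p => Multiset.replicate d (d * p)) =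
      (d • s).map (d * ·) := by
    induction s using Multiset.induction with
    | empty => simp
    | cons a s ih =>
      rw [Multiset.cons_bind, ih, Multiset.map_nsmul, Multiset.map_nsmul, Multiset.map_cons,
        ← Multiset.singleton_add, smul_add, Multiset.nsmul_singleton]
  exact this _

theorem getD_flatMap_replicate (d : ℕ) (L : List ℕ) (k r : ℕ) (hr : r < d) :
    (L.flatMap fun p => List.replicate d (d * p)).getD (d * k + r) 0 = d * L.getD k 0 := by
  induction L generalizing k with
  | nil => simp
  | cons a L ih =>
    rw [List.flatMap_cons]
    cases k with
    | zero =>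
      rw [List.getD_append _ _ _ _ (by simpa using hr)]
      simp [hr]
    | succ k =>
      rw [List.getD_append_right _ _ _ _ (by simp [Nat.mul_succ]; omega), List.getD_cons_succ,
        ← ih k]
      congr 1
      simp [Nat.mul_succ]
      omega

theorem sort_boxplus (d : ℕ) {n : ℕ} (P : Nat.Partition n) :
    (boxplus d P).parts.sort (· ≥ ·) =
      (P.parts.sort (· ≥ ·)).flatMap fun p => List.replicate d (d * p) := by
  have hsorted (L : List ℕ) (hL : L.Pairwise (· ≥ ·)) :
      (L.flatMap fun p => List.replicate d (d * p)).Pairwise (· ≥ ·) := by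
    rw [List.pairwise_flatMap]
    refine ⟨fun a _ => List.pairwise_replicate.2 (Or.inr le_rfl), hL.imp fun h x hx y hy => ?_⟩
    rw [List.eq_of_mem_replicate hx, List.eq_of_mem_replicate hy]
    exact Nat.mul_le_mul_left d h
  refine List.Perm.eq_of_pairwise' (Multiset.pairwise_sort _ _)
    (hsorted _ (Multiset.pairwise_sort _ _)) ?_
  rw [← Multiset.coe_eq_coe, Multiset.sort_eq]
  change P.parts.bind _ = _
  conv_lhs => rw [← Multiset.sort_eq P.parts (· ≥ ·)]
  exact Multiset.coe_bind _ _

theorem sum_getD_eq_sum {K : ℕ} (L : List ℕ) (hL : L.length ≤ K) :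
    ∑ i : Fin K, L.getD i 0 = L.sum := by
  rw [← Finset.sum_range fun i => L.getD i 0]
  induction L generalizing K with
  | nil => simp
  | cons a L ih =>
    obtain ⟨K, rfl⟩ := Nat.exists_eq_add_of_lt (Nat.zero_lt_of_lt hL)
    rw [zero_add, Finset.sum_range_succ', List.sum_cons, add_comm]
    simpa using ih (by simpa using hL)

/-- For `d ≥ 1` and `λ, μ ⊢ n ≥ 1`,
`χ^{⊞^d(λ)}_{⊞^d(μ)} = Σ (∏_i m_i(μ^{⊎d})!/(m_i(τ_1)!⋯m_i(τ_d)!)) χ^λ_{τ_1} ⋯ χ^λ_{τ_d}`,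
summed over `d`-tuples `(τ_1, …, τ_d)` of partitions of `n` whose multiset union is the
multiset union `μ^{⊎d}` of `d` copies of `μ`. -/
theorem boxplus_char_value_eq_sum (d n : ℕ) (hd : 1 ≤ d) (hn : 1 ≤ n)
    (lam mu : Nat.Partition n) :
    chi (boxplus d lam) (boxplus d mu) =
      ∑ τ ∈ Finset.univ.filter
          (fun τ : Fin d → Nat.Partition n => (∑ j, (τ j).parts) = d • mu.parts),
        ((∏ i ∈ Finset.range (n + 1),
            ((d • mu.parts).count i).factorial / ∏ j, ((τ j).parts.count i).factorial : ℕ) : ℤ)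
          * ∏ j, chi lam (τ j) := by
  have hnK : n ≤ d * n := Nat.le_mul_of_pos_left n hd
  set l : ℕ → ℕ := fun i => (lam.parts.sort (· ≥ ·)).getD i 0 with hl
  have hlen : (lam.parts.sort (· ≥ ·)).length ≤ n := by
    rw [Multiset.length_sort]
    calc lam.parts.card = lam.parts.card • 1 := by simp
      _ ≤ lam.parts.sum := Multiset.card_nsmul_le_sum fun p hp => lam.parts_pos hp
      _ = n := lam.parts_sum
  have hlsum : ∑ i : Fin (d * n), l i = n := by
    rw [sum_getD_eq_sum _ (hlen.trans hnK), ← Multiset.sum_coe, Multiset.sort_eq, lam.parts_sum]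
  have hchi (τ : Nat.Partition n) : chi lam τ = alternantCoeff (d * n) l τ.parts := by
    rw [chi_eq_alternantCoeff, alternantCoeff_stable hnK]
    · exact fun i hi => List.getD_eq_default _ _ (hlen.trans hi)
    · exact fun h => (τ.parts_pos h).ne rfl
  have hle (τ : Nat.Partition n) : ∀ p ∈ τ.parts, p ≤ n := fun p hp =>
    (Multiset.le_sum_of_mem hp).trans_eq τ.parts_sum
  have hmu : ∀ p ∈ d • mu.parts, p ≤ n := fun p hp => hle mu p (Multiset.mem_of_mem_nsmul hp)
  have key : chi (boxplus d lam) (boxplus d mu) =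
      ∑ k ∈ Fintype.piFinset fun i : Fin (n + 1) => piAntidiag univ ((d • mu.parts).count (i : ℕ)),
        ((∏ i, Nat.multinomial univ (k i) : ℕ) : ℤ) * ∏ r : Fin d,
          alternantCoeff (d * n) l (∑ i, Multiset.replicate (k i r) (i : ℕ)) := by
    rw [chi_eq_alternantCoeff, boxplus_parts d mu]
    generalize hl' : (fun i => ((boxplus d lam).parts.sort (· ≥ ·)).getD i 0) = l'
    have hpad : ∀ k, ∀ r < d, l' (d * k + r) = d * l k := fun k r hr => by
      simp only [← hl', hl, sort_boxplus, getD_flatMap_replicate d _ k r hr]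
    rw [mul_comm d (d * n), alternantCoeff_mul hpad,
      prod_map_sum_eq (fun r p => rename (fun k => (k, r)) (_root_.psum (d * n) p)) hmu,
      Finset.mul_sum, coeff_sum]
    refine Finset.sum_congr rfl fun k _ => ?_
    rw [mul_left_comm, ← Finset.prod_mul_distrib]
    simp only [alternantCoeff]
    rw [← coeff_prod_rename _ fun i : Fin (d * n) × Fin d => l i.1 + (d * n - 1 - (i.1 : ℕ)),
      ← Int.cast_natCast, ← eq_intCast (C : ℤ →+* _), coeff_C_mul]
    simp only [map_mul, map_multiset_prod, Multiset.map_map, Function.comp_def]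
  rw [key]
  symm
  have hrec (τ : Nat.Partition n) :
      ∑ i : Fin (n + 1), Multiset.replicate (τ.parts.count (i : ℕ)) (i : ℕ) = τ.parts :=
    sum_replicate_count (hle τ)
  refine Finset.sum_of_injOn (fun τ i r => (τ r).parts.count (i : ℕ)) ?_ ?_ ?_ ?_
  · intro τ _ τ' _ h
    funext r
    refine Nat.Partition.ext ?_
    rw [← hrec, ← hrec (τ' r)]
    exact Finset.sum_congr rfl fun i _ => congrArg (Multiset.replicate · _) (congrFun (congrFun h i) r)
  · intro τ hτ
    rw [Finset.mem_coe, Finset.mem_filter] at hτ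
    simp only [Finset.mem_coe, Fintype.mem_piFinset, mem_piAntidiag]
    exact fun i => ⟨by rw [← hτ.2, Multiset.count_sum'], fun _ _ => mem_univ _⟩
  · intro k hk hnot
    by_contra hne
    simp only [Fintype.mem_piFinset, mem_piAntidiag] at hk
    have hsum (r : Fin d) : (∑ i, Multiset.replicate (k i r) (i : ℕ)).sum = n := by
      by_contra hr
      refine hne (mul_eq_zero_of_right _ (Finset.prod_eq_zero (mem_univ r) ?_))
      exact alternantCoeff_eq_zero (hlsum.trans_ne (Ne.symm hr))
    have hcount (r : Fin d) (i : Fin (n + 1)) :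
        (∑ i, Multiset.replicate (k i r) (i : ℕ)).count (i : ℕ) = k i r := by
      rw [Multiset.count_sum']
      simp [Multiset.count_replicate, Fin.val_inj]
    have hpos (r : Fin d) {p : ℕ} (hp : p ∈ ∑ i, Multiset.replicate (k i r) (i : ℕ)) : 0 < p := by
      obtain ⟨i, -, hi⟩ := Multiset.mem_sum.1 hp
      obtain ⟨hne', rfl⟩ := Multiset.mem_replicate.1 hi
      refine Nat.pos_of_ne_zero fun h0 => hne' ?_
      have h := (hk i).1
      rw [h0, Multiset.count_eq_zero_of_notMem fun h => (mu.parts_pos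
        (Multiset.mem_of_mem_nsmul h)).ne rfl] at h
      exact Finset.sum_eq_zero_iff.1 h r (mem_univ r)
    refine hnot ⟨fun r => ⟨_, hpos r, hsum r⟩, ?_, ?_⟩
    · rw [Finset.mem_coe, Finset.mem_filter]
      refine ⟨mem_univ _, ?_⟩
      change ∑ r, ∑ i, Multiset.replicate (k i r) (i : ℕ) = _
      rw [← sum_replicate_count hmu, Finset.sum_comm]
      refine Finset.sum_congr rfl fun i _ => ?_
      rw [← (hk i).1, ← Multiset.replicateAddMonoidHom_apply, map_sum]
      rfl
    · funext i r
      exact hcount r i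
  · intro τ hτ
    rw [Finset.mem_filter] at hτ
    simp only [hrec, hchi]
    rw [Finset.prod_range]
    congr 2
    refine Finset.prod_congr rfl fun i _ => ?_
    rw [Nat.multinomial, ← Multiset.count_sum', hτ.2]
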